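/- S ⊆ R × R₂; that is, every element ((x, y), z) of S has its third component z in R₂ = ℤᵐ. Consequently Ψ takes integer values on S × S. -/

import Mathlib

open Matrix

noncomputable section

/-- `ψ_M(x, y) = xᵀ M y`, the bilinear form on `ℚᵏ` associated with an integer matrix `M`. -/
def psi {k : ℕ} (M : Matrix (Fin k) (Fin k) ℤ) (x y : Fin k → ℚ) : ℚ :=
  x ⬝ᵥ ((M.map (fun a => (a : ℚ))) *ᵥ y)

/-- A rational number is an integer. -/
def IsIntQ (q : ℚ) : Prop := ∃ a : ℤ, q = a

/-- A rational vector has integer entries, i.e. belongs to the lattice `ℤᵏ ⊂ ℚᵏ`. -/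
def IsIntVec {k : ℕ} (x : Fin k → ℚ) : Prop := ∀ i, IsIntQ (x i)

/-- `x` belongs to the dual lattice of `ℤᵏ` with respect to `ψ_M`. -/
def InDual {k : ℕ} (M : Matrix (Fin k) (Fin k) ℤ) (x : Fin k → ℚ) : Prop :=
  ∀ y, IsIntVec y → IsIntQ (psi M x y)

/-- The form `ψ_R` on `V₁ × V₁`:
`ψ_R((x,y),(x',y')) = ψ_A(x,y') + ψ_A(x',y) + ψ_A(y,y') − ψ_B(f(y),f(y'))`. -/
def psiR {n m : ℕ} (A : Matrix (Fin n) (Fin n) ℤ) (B : Matrix (Fin m) (Fin m) ℤ)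
    (f : (Fin n → ℚ) →ₗ[ℚ] (Fin m → ℚ)) (u v : (Fin n → ℚ) × (Fin n → ℚ)) : ℚ :=
  psi A u.1 v.2 + psi A v.1 u.2 + psi A u.2 v.2 - psi B (f u.2) (f v.2)

/-- Membership in the lattice `R = R₁ × R₁♯ ⊂ V₁ × V₁`. -/
def InR {n : ℕ} (A : Matrix (Fin n) (Fin n) ℤ) (u : (Fin n → ℚ) × (Fin n → ℚ)) : Prop :=
  IsIntVec u.1 ∧ InDual A u.2

/-- The ambient space `W = (V₁ × V₁) × V₂`. -/
abbrev WSp (n m : ℕ) : Type := ((Fin n → ℚ) × (Fin n → ℚ)) × (Fin m → ℚ)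

/-- The orthogonal direct sum form `Ψ = ψ_R ⊕ ψ_B` on `W`. -/
def PsiW {n m : ℕ} (A : Matrix (Fin n) (Fin n) ℤ) (B : Matrix (Fin m) (Fin m) ℤ)
    (f : (Fin n → ℚ) →ₗ[ℚ] (Fin m → ℚ)) (w w' : WSp n m) : ℚ :=
  psiR A B f w.1 w'.1 + psi B w.2 w'.2

/-- The map `ι : V₁ → W`, `ι(y) = ((0, y), f(y))`. -/
def iota {n m : ℕ} (f : (Fin n → ℚ) →ₗ[ℚ] (Fin m → ℚ)) (y : Fin n → ℚ) : WSp n m :=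
  ((0, y), f y)

/-- Membership in `S = {z ∈ R × R₂♯ : Ψ(z, ι(r)) = 0 for all r ∈ R₁♯}`. -/
def InS {n m : ℕ} (A : Matrix (Fin n) (Fin n) ℤ) (B : Matrix (Fin m) (Fin m) ℤ)
    (f : (Fin n → ℚ) →ₗ[ℚ] (Fin m → ℚ)) (w : WSp n m) : Prop :=
  (InR A w.1 ∧ InDual B w.2) ∧ ∀ r, InDual A r → PsiW A B f w (iota f r) = 0

theorem IsIntQ.add' {a b : ℚ} (ha : IsIntQ a) (hb : IsIntQ b) : IsIntQ (a + b) := by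
  obtain ⟨x, rfl⟩ := ha
  obtain ⟨y, rfl⟩ := hb
  exact ⟨x + y, by push_cast; rfl⟩

theorem IsIntQ.sub' {a b : ℚ} (ha : IsIntQ a) (hb : IsIntQ b) : IsIntQ (a - b) := by
  obtain ⟨x, rfl⟩ := ha
  obtain ⟨y, rfl⟩ := hb
  exact ⟨x - y, by push_cast; rfl⟩

theorem psi_comm' {k : ℕ} (M : Matrix (Fin k) (Fin k) ℤ) (hM : M.IsSymm) (x y : Fin k → ℚ) :
    psi M x y = psi M y x := by
  unfold psi
  have h : (M.map (fun a => (a : ℚ)))ᵀ = M.map (fun a => (a : ℚ)) := by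
    rw [← Matrix.transpose_map, hM.eq]
  rw [Matrix.dotProduct_mulVec, ← Matrix.mulVec_transpose, h, dotProduct_comm]

theorem double_dual {k : ℕ} (M : Matrix (Fin k) (Fin k) ℤ) (hM : M.IsSymm) (hd : M.det ≠ 0)
    (z : Fin k → ℚ) (hz : ∀ t, InDual M t → IsIntQ (psi M z t)) : IsIntVec z := by
  intro i
  have hu : IsUnit (M.map (fun a => (a : ℚ))).det := by
    have h : (M.map (fun a => (a : ℚ))).det = (M.det : ℚ) := by
      have := (Int.castRingHom ℚ).map_det M
      simpa [RingHom.mapMatrix_apply] using this.symm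
    rw [h, isUnit_iff_ne_zero]
    exact_mod_cast hd
  have key : ∀ y, psi M y ((M.map (fun a => (a : ℚ)))⁻¹ *ᵥ Pi.single i 1) = y i := by
    intro y
    unfold psi
    rw [Matrix.mulVec_mulVec, Matrix.mul_nonsing_inv _ hu, Matrix.one_mulVec]
    simp
  have := hz ((M.map (fun a => (a : ℚ)))⁻¹ *ᵥ Pi.single i 1) (by
    intro y hy
    rw [psi_comm' M hM, key]
    exact hy i)
  rwa [key] at this

/-- `S ⊆ R × R₂`, and consequently `Ψ` takes integer values on `S × S`. -/
theorem S_subset_and_integral {n m : ℕ}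
    (A : Matrix (Fin n) (Fin n) ℤ) (hAsym : A.IsSymm) (hAdet : A.det ≠ 0)
    (B : Matrix (Fin m) (Fin m) ℤ) (hBsym : B.IsSymm) (hBdet : B.det ≠ 0)
    (f : (Fin n → ℚ) →ₗ[ℚ] (Fin m → ℚ))
    (hfdual : ∀ x, InDual A x → InDual B (f x))
    (hfint : ∀ x, IsIntVec x → IsIntVec (f x))
    (hfinj : ∀ x, InDual A x → IsIntVec (f x) → IsIntVec x)
    (hfsurj : ∀ z, InDual B z → ∃ x, InDual A x ∧ IsIntVec (z - f x))
    (hfiso : ∀ x y, InDual A x → InDual A y → IsIntQ (psi B (f x) (f y) - psi A x y)) :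
    (∀ w : WSp n m, InS A B f w → IsIntVec w.2) ∧
    (∀ w w' : WSp n m, InS A B f w → InS A B f w' → IsIntQ (PsiW A B f w w')) := by
  have h1 : ∀ w : WSp n m, InS A B f w → IsIntVec w.2 := by
    rintro ⟨⟨x, y⟩, z⟩ ⟨⟨⟨hx, hy⟩, hz⟩, h⟩
    simp only at hx hy hz
    refine double_dual B hBsym hBdet z ?_
    intro t ht
    obtain ⟨r, hr, hrt⟩ := hfsurj t ht
    have e := h r hr
    simp only [PsiW, psiR, iota] at e
    have e0 : psi A 0 y = 0 := by simp [psi]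
    have e1 : psi B z t = psi B z (t - f r) + psi B z (f r) := by
      simp [psi, Matrix.mulVec_sub]
    have e2 : psi B z t = psi B z (t - f r) + ((psi B (f y) (f r) - psi A y r) - psi A r x) := by
      rw [psi_comm' A hAsym r x]
      linarith
    rw [e2]
    exact (hz _ hrt).add' ((hfiso y r hy hr).sub' (hr x hx))
  refine ⟨h1, ?_⟩
  intro w w' hw hw'
  have hz' := h1 w' hw'
  obtain ⟨⟨⟨hx, hy⟩, hz⟩, -⟩ := hw
  obtain ⟨⟨⟨hx', hy'⟩, -⟩, -⟩ := hw'
  have e : PsiW A B f w w' = ((psi A w'.1.2 w.1.1 + psi A w.1.2 w'.1.1)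
      - (psi B (f w.1.2) (f w'.1.2) - psi A w.1.2 w'.1.2)) + psi B w.2 w'.2 := by
    rw [psi_comm' A hAsym w'.1.2 w.1.1, psi_comm' A hAsym w.1.2 w'.1.1]
    simp only [PsiW, psiR]
    ring
  rw [e]
  exact (((hy' _ hx).add' (hy _ hx')).sub' (hfiso _ _ hy hy')).add' (hz _ hz')
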